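/- arXiv:2006.05028 — 11 statements merged into one kernel-verified Lean document; each statement's English description precedes it below -/
import Mathlib

section
/- Let L be a positive integer with L ≤ D and set ε = L/D, let q ∈ (0, 1/2), and assume n is a multiple of L and n ≥ L. Let s and ŝ be request sequences such that m(I) ≤ qL for every interval I ⊆ {1,…,n} of length L. Let a be a position sequence that is constant on each block {(j−1)L+1,…,jL} (for j = 1,…,n/L) and that minimizes cost(·, ŝ) among all position sequences constant on these blocks. Then cost(a, s) ≤ (1+ε)·((1+2q)/(1−2q))·OPT(s). -/
open Finset

/-- Total cost of position sequence `a` serving requests `s 1, …, s n`: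
`∑ t, (D * d(a (t-1), a t) + d(a t, s t))`. -/
noncomputable def pmCost {X : Type*} [MetricSpace X] (D : ℝ) (n : ℕ) (a s : ℕ → X) : ℝ :=
  ∑ t ∈ Finset.Icc 1 n, (D * dist (a (t - 1)) (a t) + dist (a t) (s t))

/-- Optimal offline cost: infimum of `pmCost` over all position sequences
(maps `b : ℕ → X` with `b 0 = p₀`). -/
noncomputable def pmOPT {X : Type*} [MetricSpace X] (D : ℝ) (p₀ : X) (n : ℕ) (s : ℕ → X) : ℝ :=
  sInf {c : ℝ | ∃ b : ℕ → X, b 0 = p₀ ∧ pmCost D n b s = c}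

open Classical in
/-- Number of mismatches between `s` and `shat` on the index set `I`. -/
noncomputable def mismatches {X : Type*} (s shat : ℕ → X) (I : Finset ℕ) : ℕ :=
  (I.filter fun t => s t ≠ shat t).card

/-- A position sequence is constant on each block `{(j-1)L+1, …, jL}`, `j = 1, …, n/L`. -/
def BlockConst {X : Type*} (L n : ℕ) (a : ℕ → X) : Prop :=
  ∀ j ∈ Finset.Icc 1 (n / L), ∀ t ∈ Finset.Icc ((j - 1) * L + 1) (j * L),
    ∀ t' ∈ Finset.Icc ((j - 1) * L + 1) (j * L), a t = a t'


theorem BlockConst.eq_last {X : Type*} {L k : ℕ} (hL : 0 < L) {a : ℕ → X}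
    (ha : BlockConst L (k * L) a) {j t : ℕ} (hj : j < k)
    (ht : t ∈ Finset.Icc (j * L + 1) (j * L + L)) : a t = a (j * L + L) := by
  have hblock := ha (j + 1) (by
    rw [Nat.mul_div_cancel _ hL, Finset.mem_Icc]
    omega)
  rw [Nat.add_sub_cancel, Nat.add_mul, Nat.one_mul] at hblock
  exact hblock t ht _ (Finset.mem_Icc.mpr ⟨by omega, le_rfl⟩)

/-- A sum over `{1, …, k * L}` splits into the sums over the `k` consecutive blocks of length `L`. -/
theorem sum_Icc_mul_eq_sum_blocks (L k : ℕ) (f : ℕ → ℝ) :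
    ∑ t ∈ Finset.Icc 1 (k * L), f t =
      ∑ j ∈ Finset.range k, ∑ t ∈ Finset.Icc (j * L + 1) (j * L + L), f t := by
  induction k with
  | zero => simp
  | succ k ih =>
    have hunion : Finset.Icc 1 ((k + 1) * L) =
        Finset.Icc 1 (k * L) ∪ Finset.Icc (k * L + 1) (k * L + L) := by
      ext t
      simp only [Finset.mem_Icc, Finset.mem_union, Nat.add_mul, Nat.one_mul]
      omega
    have hdisj : Disjoint (Finset.Icc 1 (k * L)) (Finset.Icc (k * L + 1) (k * L + L)) := by
      rw [Finset.disjoint_left]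
      intro t
      simp only [Finset.mem_Icc]
      omega
    rw [Finset.sum_range_succ, ← ih, hunion, Finset.sum_union hdisj]

/-- Replacing the requests `s` by `shat` changes the difference of the service costs at two points
by at most twice their distance per mismatch. -/
theorem sum_dist_sub_le_add_mismatches {X : Type*} [MetricSpace X] (s shat : ℕ → X)
    (I : Finset ℕ) (x y : X) :
    ∑ t ∈ I, (dist x (s t) - dist y (s t)) ≤
      ∑ t ∈ I, (dist x (shat t) - dist y (shat t)) + mismatches s shat I * (2 * dist x y) := by
  classical
  have hcard : (mismatches s shat I : ℝ) * (2 * dist x y) =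
      ∑ t ∈ I, if s t ≠ shat t then 2 * dist x y else 0 := by
    rw [← Finset.sum_filter, Finset.sum_const, nsmul_eq_mul, mismatches]
  rw [hcard, ← Finset.sum_add_distrib]
  refine Finset.sum_le_sum fun t _ => ?_
  split_ifs with h
  · linarith [dist_triangle x y (s t), dist_triangle y x (shat t), dist_comm x y]
  · rw [not_not.mp h, add_zero]

theorem card_mul_dist_le_sum {X : Type*} [MetricSpace X] (s : ℕ → X) (I : Finset ℕ) (x y : X) :
    I.card * dist x y ≤ ∑ t ∈ I, (dist x (s t) + dist y (s t)) := by
  rw [← nsmul_eq_mul]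
  exact Finset.card_nsmul_le_sum _ _ _ fun t _ => dist_triangle_right x y (s t)

theorem sum_dist_sub_le_of_mismatches_le {X : Type*} [MetricSpace X] (s shat : ℕ → X)
    (I : Finset ℕ) (q : ℝ) (hq : 0 ≤ q) (hI : (mismatches s shat I : ℝ) ≤ q * I.card) (x y : X) :
    ∑ t ∈ I, (dist x (s t) - dist y (s t)) ≤
      ∑ t ∈ I, (dist x (shat t) - dist y (shat t) +
        2 * q * (dist x (s t) + dist y (s t))) := by
  rw [Finset.sum_add_distrib, ← Finset.mul_sum]
  have h₁ := sum_dist_sub_le_add_mismatches s shat I x y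
  have h₂ := mul_le_mul_of_nonneg_right hI (by positivity : 0 ≤ 2 * dist x y)
  have h₃ := mul_le_mul_of_nonneg_left (card_mul_dist_le_sum s I x y)
    (by positivity : 0 ≤ 2 * q)
  linarith

/-- A block-constant sequence which is no more expensive than another one on `shat` is, on `s`,
at most `(1 + 2q) / (1 - 2q)` times as expensive as the other one. -/
theorem pmCost_le_of_blockConst {X : Type*} [MetricSpace X] {D q : ℝ} (hD : 0 ≤ D)
    (hq : 0 ≤ q) {L k : ℕ} (hL : 0 < L) {s shat a b : ℕ → X}
    (hm : ∀ j < k,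
      (mismatches s shat (Finset.Icc (j * L + 1) (j * L + L)) : ℝ) ≤ q * L)
    (ha : BlockConst L (k * L) a) (hb : BlockConst L (k * L) b)
    (hab : pmCost D (k * L) a shat ≤ pmCost D (k * L) b shat) :
    (1 - 2 * q) * pmCost D (k * L) a s ≤ (1 + 2 * q) * pmCost D (k * L) b s := by
  have hserv : ∑ t ∈ Finset.Icc 1 (k * L), (dist (a t) (s t) - dist (b t) (s t)) ≤
      ∑ t ∈ Finset.Icc 1 (k * L), (dist (a t) (shat t) - dist (b t) (shat t) +
        2 * q * (dist (a t) (s t) + dist (b t) (s t))) := by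
    rw [sum_Icc_mul_eq_sum_blocks, sum_Icc_mul_eq_sum_blocks]
    refine Finset.sum_le_sum fun j hj => ?_
    have hj := Finset.mem_range.mp hj
    have h := sum_dist_sub_le_of_mismatches_le s shat (Finset.Icc (j * L + 1) (j * L + L)) q hq
      (by simpa using hm j hj) (a (j * L + L)) (b (j * L + L))
    refine (Finset.sum_congr rfl fun t ht => ?_).trans_le
      (h.trans_eq (Finset.sum_congr rfl fun t ht => ?_)) <;>
    rw [ha.eq_last hL hj ht, hb.eq_last hL hj ht]
  have hmove (c : ℕ → X) : 0 ≤ ∑ t ∈ Finset.Icc 1 (k * L), dist (c (t - 1)) (c t) :=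
    Finset.sum_nonneg fun _ _ => dist_nonneg
  have hqa := mul_nonneg (mul_nonneg hq hD) (hmove a)
  have hqb := mul_nonneg (mul_nonneg hq hD) (hmove b)
  simp only [Finset.sum_sub_distrib, Finset.sum_add_distrib, ← Finset.mul_sum] at hserv
  simp only [pmCost, Finset.sum_add_distrib, ← Finset.mul_sum] at hab ⊢
  linarith

/-- The last time of the block of length `L` that contains time `t`. -/
def blockEnd (L t : ℕ) : ℕ := (t + L - 1) / L * L

theorem blockEnd_mul {L : ℕ} (hL : 0 < L) (j : ℕ) : blockEnd L (j * L) = j * L := by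
  rw [blockEnd, Nat.add_sub_assoc hL, Nat.add_comm, Nat.add_mul_div_right _ _ hL,
    Nat.div_eq_of_lt (by omega), Nat.zero_add]

theorem blockEnd_eq {L j t : ℕ} (ht : t ∈ Finset.Icc (j * L + 1) (j * L + L)) :
    blockEnd L t = j * L + L := by
  rw [Finset.mem_Icc] at ht
  have hdiv : (t + L - 1) / L = j + 1 := by
    apply Nat.div_eq_of_lt_le <;> simp only [Nat.add_mul, Nat.one_mul] <;> omega
  rw [blockEnd, hdiv, Nat.add_mul, Nat.one_mul]

theorem blockConst_comp_blockEnd {X : Type*} (L n : ℕ) (b : ℕ → X) :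
    BlockConst L n fun t => b (blockEnd L t) := by
  intro j hj t ht u hu
  obtain ⟨i, rfl⟩ := Nat.exists_eq_add_of_le' (Finset.mem_Icc.mp hj).1
  rw [Nat.add_sub_cancel, Nat.add_mul, Nat.one_mul] at ht hu
  simp only [blockEnd_eq ht, blockEnd_eq hu]

/-- Two positions of a sequence at times in `{m, …, m + L}` differ by at most its total movement
in that window. -/
theorem dist_le_sum_Icc_dist {X : Type*} [MetricSpace X] (b : ℕ → X) {m L u : ℕ}
    (hmu : m ≤ u) (huL : u ≤ m + L) :
    dist (b u) (b (m + L)) ≤ ∑ t ∈ Finset.Icc (m + 1) (m + L), dist (b (t - 1)) (b t) := by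
  have himage : Finset.Icc (m + 1) (m + L) = (Finset.Ico m (m + L)).image (· + 1) := by
    rw [Finset.image_add_right_Ico]
    ext t
    simp only [Finset.mem_Icc, Finset.mem_Ico]
    omega
  rw [himage, Finset.sum_image fun _ _ _ _ h => Nat.succ_injective h]
  exact (dist_le_Ico_sum_dist b huL).trans <| Finset.sum_le_sum_of_subset_of_nonneg
    (Finset.Ico_subset_Ico_left hmu) fun _ _ _ => dist_nonneg

/-- Making a position sequence constant on the blocks of length `L` costs at most a factor
`1 + L / D`. -/
theorem pmCost_comp_blockEnd_le {X : Type*} [MetricSpace X] {D : ℝ} (hD : 0 < D) {L : ℕ}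
    (hL : 0 < L) (k : ℕ) (b s : ℕ → X) :
    pmCost D (k * L) (fun t => b (blockEnd L t)) s ≤ (1 + L / D) * pmCost D (k * L) b s := by
  simp only [pmCost]
  rw [sum_Icc_mul_eq_sum_blocks, sum_Icc_mul_eq_sum_blocks, Finset.mul_sum]
  refine Finset.sum_le_sum fun j _ => ?_
  set I := Finset.Icc (j * L + 1) (j * L + L) with hI
  set V := ∑ t ∈ I, dist (b (t - 1)) (b t) with hV
  have hfirst : j * L + 1 ∈ I := Finset.mem_Icc.mpr ⟨le_rfl, by omega⟩
  have hmove : ∑ t ∈ I, dist (b (blockEnd L (t - 1))) (b (blockEnd L t)) ≤ V := by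
    rw [Finset.sum_eq_single_of_mem _ hfirst]
    · rw [Nat.add_sub_cancel, blockEnd_mul hL, blockEnd_eq hfirst]
      exact dist_le_sum_Icc_dist b le_rfl (by omega)
    · intro t ht hne
      have hpred : t - 1 ∈ I := by
        rw [hI, Finset.mem_Icc] at ht ⊢
        omega
      rw [blockEnd_eq ht, blockEnd_eq hpred, dist_self]
  have hserv : ∑ t ∈ I, dist (b (blockEnd L t)) (s t) ≤ L * V + ∑ t ∈ I, dist (b t) (s t) := by
    have hcard : (L : ℝ) * V = ∑ t ∈ I, V := by simp [hI]
    rw [hcard, ← Finset.sum_add_distrib]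
    refine Finset.sum_le_sum fun t ht => ?_
    have hwin := Finset.mem_Icc.mp ht
    rw [blockEnd_eq ht]
    refine (dist_triangle_left _ _ (b t)).trans ?_
    exact add_le_add_left (dist_le_sum_Icc_dist b (by omega) hwin.2) _
  have hS : 0 ≤ L / D * ∑ t ∈ I, dist (b t) (s t) := by positivity
  have hDV : L / D * (D * V) = L * V := by field_simp
  have hDmove := mul_le_mul_of_nonneg_left hmove hD.le
  simp only [Finset.sum_add_distrib, ← Finset.mul_sum]
  rw [← hV]
  linarith

/-- If every interval of length `L` (with `ε = L/D`) has at most `qL`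
mismatches between `s` and `ŝ`, `n` is a multiple of `L`, and `a` is a position sequence,
constant on every block of length `L`, that is optimal for `ŝ` among all such block-constant
position sequences, then `cost(a, s) ≤ (1+ε)·((1+2q)/(1−2q))·OPT(s)`. -/
theorem stmt0 {X : Type*} [MetricSpace X] (D : ℝ) (hD : 1 ≤ D) (p₀ : X) (n L : ℕ)
    (hL : 0 < L) (hLD : (L : ℝ) ≤ D) (q : ℝ) (hq0 : 0 < q) (hq1 : q < 1 / 2)
    (hdvd : L ∣ n) (hLn : L ≤ n) (s shat : ℕ → X)
    (hm : ∀ i : ℕ, i + L ≤ n →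
      (mismatches s shat (Finset.Icc (i + 1) (i + L)) : ℝ) ≤ q * L)
    (a : ℕ → X) (ha0 : a 0 = p₀) (haB : BlockConst L n a)
    (haopt : ∀ b : ℕ → X, b 0 = p₀ → BlockConst L n b →
      pmCost D n a shat ≤ pmCost D n b shat) :
    pmCost D n a s ≤ (1 + (L : ℝ) / D) * ((1 + 2 * q) / (1 - 2 * q)) * pmOPT D p₀ n s := by
  obtain ⟨k, rfl⟩ := hdvd
  rw [Nat.mul_comm L k] at *
  have hD₀ : 0 < D := by linarith
  have hq : 0 < 1 - 2 * q := by linarith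
  have hmul : ∀ j < k,
      (mismatches s shat (Finset.Icc (j * L + 1) (j * L + L)) : ℝ) ≤ q * L := fun j hj =>
    hm (j * L) (by simpa [Nat.add_mul] using Nat.mul_le_mul_right L (Nat.succ_le_of_lt hj))
  have hC : 0 < (1 + (L : ℝ) / D) * ((1 + 2 * q) / (1 - 2 * q)) := by positivity
  rw [← div_le_iff₀' hC]
  refine le_csInf ⟨_, fun _ => p₀, rfl, rfl⟩ ?_
  rintro _ ⟨b, hb₀, rfl⟩
  rw [div_le_iff₀' hC]
  have hbB := blockConst_comp_blockEnd L (k * L) b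
  have hzero : blockEnd L 0 = 0 := by simpa using blockEnd_mul hL 0
  have hcompare := pmCost_le_of_blockConst hD₀.le hq0.le hL hmul haB hbB
    (haopt _ (by rw [hzero, hb₀]) hbB)
  have hround := mul_le_mul_of_nonneg_left (pmCost_comp_blockEnd_le hD₀ hL k b s)
    (by positivity : 0 ≤ 1 + 2 * q)
  calc pmCost D (k * L) a s
      ≤ (1 + 2 * q) * ((1 + L / D) * pmCost D (k * L) b s) / (1 - 2 * q) := by
        rw [le_div_iff₀' hq]
        exact hcompare.trans hround
    _ = _ := by ring
end

section
/- Assume (X,d) is a uniform metric space (d(x,y) = 1 for all x ≠ y), D is a positive integer, q ∈ (0, 1/4), and n ≥ D. Let s and ŝ be request sequences such that m(I) ≤ qD for every interval I ⊆ {1,…,n} of length D. Let a be a position sequence satisfying cost(a, ŝ) ≤ cost(b, ŝ) for every position sequence b (i.e., a is an optimal offline solution for ŝ). Then cost(a, s) ≤ ((1+4q)/(1−4q))·OPT(s). -/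
open Finset

/-- A process `e` with values in `{0, 1}` starting at `0`, whose increases are dominated by `v`,
collects at most `q * ∑ (D * v t + e t)` weight from any `m` putting mass at most `q * D` on each
window of length `D`. -/
theorem sum_mul_le_of_window_bound (D n : ℕ) (hD : 0 < D) (hn : D ≤ n) (q : ℝ) (hq : 0 ≤ q)
    (e v m : ℕ → ℝ) (he : ∀ t, e t = 0 ∨ e t = 1) (he0 : e 0 = 0) (hv : ∀ t, 0 ≤ v t)
    (hev : ∀ t, e (t + 1) ≤ e t + v (t + 1)) (hm : ∀ t, 0 ≤ m t)
    (hw : ∀ i, i + D ≤ n → ∑ t ∈ Finset.Ioc i (i + D), m t ≤ q * D) (k : ℕ) (hk : k ≤ n) :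
    ∑ t ∈ Finset.Ioc 0 k, m t * e t ≤ q * ∑ t ∈ Finset.Ioc 0 k, (D * v t + e t) := by
  have e_nonneg : ∀ t, 0 ≤ e t := fun t => by rcases he t with h | h <;> simp [h]
  have e_le_one : ∀ t, e t ≤ 1 := fun t => by rcases he t with h | h <;> simp [h]
  have increase_le : ∀ i j, i ≤ j → e j ≤ e i + ∑ t ∈ Finset.Ioc i j, v t := by
    intro i j hij
    induction j, hij using Nat.le_induction with
    | base => simp
    | succ j hij ih =>
      rw [Finset.sum_Ioc_succ_top hij]
      linarith [hev j]
  induction k using Nat.strong_induction_on with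
  | _ k ih =>
    rcases Nat.eq_zero_or_pos k with rfl | hk0
    · simp
    rcases he k with hek | hek
    · obtain ⟨l, rfl⟩ : ∃ l, k = l + 1 := ⟨k - 1, by omega⟩
      have := ih l (by omega) (by omega)
      rw [Finset.sum_Ioc_succ_top (Nat.zero_le l), Finset.sum_Ioc_succ_top (Nat.zero_le l), hek]
      have : 0 ≤ q * (D * v (l + 1)) := mul_nonneg hq (mul_nonneg (Nat.cast_nonneg D) (hv _))
      linarith
    · have hjk : k - D ≤ k := Nat.sub_le k D
      have prev := ih (k - D) (by omega) (by omega)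
      have weight_le : ∑ t ∈ Finset.Ioc (k - D) k, m t * e t ≤ q * D := by
        calc ∑ t ∈ Finset.Ioc (k - D) k, m t * e t
            ≤ ∑ t ∈ Finset.Ioc (k - D) k, m t :=
              Finset.sum_le_sum fun t _ => mul_le_of_le_one_right (hm t) (e_le_one t)
          _ ≤ ∑ t ∈ Finset.Ioc (k - D) (k - D + D), m t :=
              Finset.sum_le_sum_of_subset_of_nonneg
                (Finset.Ioc_subset_Ioc le_rfl (by omega)) fun t _ _ => hm t
          _ ≤ q * D := hw _ (by omega)
      have le_cost : (D : ℝ) ≤ ∑ t ∈ Finset.Ioc (k - D) k, (D * v t + e t) := by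
        rw [Finset.sum_add_distrib, ← Finset.mul_sum]
        have hsum_e : 0 ≤ ∑ t ∈ Finset.Ioc (k - D) k, e t := Finset.sum_nonneg fun t _ => e_nonneg t
        by_cases hz : ∃ i, k - D ≤ i ∧ i ≤ k ∧ e i = 0
        · obtain ⟨i, hi, hik, hei⟩ := hz
          have h1 : 1 ≤ ∑ t ∈ Finset.Ioc (k - D) k, v t := by
            have := increase_le i k hik
            have : ∑ t ∈ Finset.Ioc i k, v t ≤ ∑ t ∈ Finset.Ioc (k - D) k, v t :=
              Finset.sum_le_sum_of_subset_of_nonneg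
                (Finset.Ioc_subset_Ioc hi le_rfl) fun t _ _ => hv t
            linarith
          have : (D : ℝ) * 1 ≤ D * ∑ t ∈ Finset.Ioc (k - D) k, v t :=
            mul_le_mul_of_nonneg_left h1 (Nat.cast_nonneg D)
          linarith
        · push Not at hz
          have hDk : D ≤ k := by
            by_contra h
            exact hz 0 (by omega) (by omega) he0
          have h1 : ∑ t ∈ Finset.Ioc (k - D) k, e t = D := by
            rw [Finset.sum_congr rfl fun t ht => (he t).resolve_left
              (hz t (Finset.mem_Ioc.1 ht).1.le (Finset.mem_Ioc.1 ht).2)]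
            simp [Nat.sub_sub_self hDk]
          have : 0 ≤ (D : ℝ) * ∑ t ∈ Finset.Ioc (k - D) k, v t :=
            mul_nonneg (Nat.cast_nonneg D) (Finset.sum_nonneg fun t _ => hv t)
          linarith
      rw [← Finset.sum_Ioc_consecutive _ (Nat.zero_le (k - D)) hjk,
        ← Finset.sum_Ioc_consecutive (fun t => (D : ℝ) * v t + e t) (Nat.zero_le (k - D)) hjk,
        mul_add]
      exact add_le_add prev (weight_le.trans (mul_le_mul_of_nonneg_left le_cost hq))

theorem pmCost_nonneg {X : Type*} [MetricSpace X] {D : ℝ} (hD : 0 ≤ D) (n : ℕ) (a s : ℕ → X) :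
    0 ≤ pmCost D n a s :=
  Finset.sum_nonneg fun _ _ => by positivity

open Classical in
theorem dist_sub_dist_le_of_uniform {X : Type*} [MetricSpace X]
    (huni : ∀ x y : X, x ≠ y → dist x y = 1) (x y z w : X) :
    dist x z - dist y z ≤ dist x w - dist y w + 2 * ((if z ≠ w then 1 else 0) * dist x y) := by
  have dist_le_one : ∀ u v : X, dist u v ≤ 1 := fun u v => by
    by_cases h : u = v
    · simp [h]
    · exact (huni u v h).le
  by_cases hzw : z = w
  · simp [hzw]
  by_cases hxy : x = y
  · simp [hxy]
  rw [if_pos hzw, huni x y hxy]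
  linarith [dist_le_one x z, dist_le_one y w, @dist_nonneg _ _ y z, @dist_nonneg _ _ x w]

open Classical in
/-- In a uniform space, an optimal solution for `shat` compared with any other solution on `s`. -/
theorem pmCost_sub_le {X : Type*} [MetricSpace X]
    (huni : ∀ x y : X, x ≠ y → dist x y = 1)
    (D : ℕ) (hD : 0 < D) (n : ℕ) (hn : D ≤ n) (q : ℝ) (hq : 0 ≤ q) (s shat : ℕ → X)
    (hm : ∀ i : ℕ, i + D ≤ n →
      (mismatches s shat (Finset.Icc (i + 1) (i + D)) : ℝ) ≤ q * D)
    (a b : ℕ → X) (hab : a 0 = b 0) (hle : pmCost (D : ℝ) n a shat ≤ pmCost (D : ℝ) n b shat) :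
    pmCost (D : ℝ) n a s - pmCost (D : ℝ) n b s ≤
      2 * (q * (pmCost (D : ℝ) n a s + pmCost (D : ℝ) n b s)) := by
  have key := sum_mul_le_of_window_bound D n hD hn q hq (fun t => dist (a t) (b t))
    (fun t => dist (a (t - 1)) (a t) + dist (b (t - 1)) (b t))
    (fun t => if s t ≠ shat t then 1 else 0)
    (fun t => by
      by_cases h : a t = b t
      · exact .inl (by simp [h])
      · exact .inr (huni _ _ h))
    (by simp [hab]) (fun t => by positivity)
    (fun t => by
      have := dist_triangle4 (a (t + 1)) (a t) (b t) (b (t + 1))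
      rw [dist_comm (a (t + 1)) (a t)] at this
      simp only [Nat.add_sub_cancel]
      linarith)
    (fun t => by positivity)
    (fun i hi => by
      have h := hm i hi
      rw [mismatches, Finset.card_filter] at h
      push_cast at h
      rwa [← Order.succ_eq_add_one i, Finset.Icc_succ_left_eq_Ioc] at h) n le_rfl
  have cost_le : ∑ t ∈ Finset.Ioc 0 n, ((D : ℝ) * (dist (a (t - 1)) (a t) +
      dist (b (t - 1)) (b t)) + dist (a t) (b t)) ≤
      pmCost (D : ℝ) n a s + pmCost (D : ℝ) n b s := by
    rw [pmCost, pmCost, ← Finset.sum_add_distrib]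
    refine Finset.sum_le_sum fun t _ => ?_
    linarith [dist_triangle_right (a t) (b t) (s t)]
  have diff_le : pmCost (D : ℝ) n a s - pmCost (D : ℝ) n b s ≤
      pmCost (D : ℝ) n a shat - pmCost (D : ℝ) n b shat +
      2 * ∑ t ∈ Finset.Ioc 0 n, (if s t ≠ shat t then 1 else 0) * dist (a t) (b t) := by
    simp only [pmCost]
    rw [← Finset.sum_sub_distrib, ← Finset.sum_sub_distrib, Finset.mul_sum]
    refine le_trans (Finset.sum_le_sum fun t _ => ?_) Finset.sum_add_distrib.le
    linarith [dist_sub_dist_le_of_uniform huni (a t) (b t) (s t) (shat t)]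
  linarith [mul_le_mul_of_nonneg_left cost_le hq]

/-- In a uniform metric space (`d(x,y) = 1` for `x ≠ y`), with `D` a positive
integer, `q ∈ (0, 1/4)`, `n ≥ D`, if every interval of length `D` has at most `qD` mismatches
between `s` and `ŝ`, and `a` is an optimal offline position sequence for `ŝ`, then
`cost(a, s) ≤ ((1+4q)/(1−4q))·OPT(s)`. -/
theorem stmt1 {X : Type*} [MetricSpace X]
    (huni : ∀ x y : X, x ≠ y → dist x y = 1)
    (D : ℕ) (hD : 0 < D) (p₀ : X) (n : ℕ) (hn : D ≤ n)
    (q : ℝ) (hq0 : 0 < q) (hq1 : q < 1 / 4)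
    (s shat : ℕ → X)
    (hm : ∀ i : ℕ, i + D ≤ n →
      (mismatches s shat (Finset.Icc (i + 1) (i + D)) : ℝ) ≤ q * D)
    (a : ℕ → X) (ha0 : a 0 = p₀)
    (haopt : ∀ b : ℕ → X, b 0 = p₀ → pmCost (D : ℝ) n a shat ≤ pmCost (D : ℝ) n b shat) :
    pmCost (D : ℝ) n a s ≤ (1 + 4 * q) / (1 - 4 * q) * pmOPT (D : ℝ) p₀ n s := by
  have hpos : 0 < 1 - 4 * q := by linarith
  rw [div_mul_eq_mul_div, le_div_iff₀ hpos, mul_comm, ← div_le_iff₀' (by linarith)]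
  refine le_csInf ⟨_, fun _ => p₀, rfl, rfl⟩ ?_
  rintro _ ⟨b, hb0, rfl⟩
  rw [div_le_iff₀' (by linarith)]
  have h := pmCost_sub_le huni D hD n hn q hq0.le s shat hm a b (ha0.trans hb0.symm) (haopt b hb0)
  have hnn := mul_nonneg hq0.le (add_nonneg (pmCost_nonneg (Nat.cast_nonneg (α := ℝ) D) n a s)
    (pmCost_nonneg (Nat.cast_nonneg (α := ℝ) D) n b s))
  linarith
end

section
/- Let L be a positive integer, let s be a request sequence, and let p be any position sequence. Define the lazy position sequence p' by p'(t) = p(L·⌊t/L⌋) for all t ∈ {0,…,n}, i.e., p' changes its position only at time steps that are multiples of L, and at such a time it moves to the position where p is at that time step. Then cost(p', s) ≤ cost(p, s) + L·Σ_{i=1}^n d(p(i−1), p(i)); in particular cost(p', s) ≤ (1 + L/D)·cost(p, s). -/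
open Finset

/-- Potential-function bound for the lazy sequence: besides the distance between the lazy and the
original position weighted by `D`, it pays in advance for that distance until the next multiple
of `L`. -/
theorem pmCost_lazy_add_potential_le {X : Type*} [MetricSpace X] {D : ℝ} (hD : 0 ≤ D) (n : ℕ)
    {L : ℕ} (hL : 0 < L) (s p : ℕ → X) :
    pmCost D n (fun t => p (L * (t / L))) s
        + (D + ((L : ℝ) - 1 - (n % L : ℕ))) * dist (p (L * (n / L))) (p n) ≤
      pmCost D n p s + L * ∑ i ∈ Finset.Icc 1 n, dist (p (i - 1)) (p i) := by
  induction n with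
  | zero => simp [pmCost]
  | succ n ih =>
    unfold pmCost at ih ⊢
    simp only [Finset.sum_Icc_succ_top (Nat.le_add_left 1 n), Nat.add_sub_cancel]
    have hr : ((n % L : ℕ) : ℝ) + 1 ≤ L := by exact_mod_cast Nat.mod_lt n hL
    have hr0 : (0 : ℝ) ≤ (n % L : ℕ) := Nat.cast_nonneg _
    have htri := dist_triangle (p (L * (n / L))) (p n) (p (n + 1))
    have hδ : 0 ≤ dist (p n) (p (n + 1)) := dist_nonneg
    have hd : 0 ≤ dist (p (L * (n / L))) (p n) := dist_nonneg
    by_cases h : L ∣ n + 1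
    · rw [Nat.mul_div_cancel' h, dist_self]
      nlinarith [mul_le_mul_of_nonneg_left htri hD,
        mul_nonneg (sub_nonneg.2 hr) hd, mul_nonneg (Nat.cast_nonneg (α := ℝ) L) hδ]
    · have hdiv : (n + 1) / L = n / L := Nat.succ_div_of_not_dvd h
      have hmod : (n + 1) % L = n % L + 1 := by
        have h1 := Nat.div_add_mod (n + 1) L
        have h2 := Nat.div_add_mod n L
        rw [hdiv] at h1
        omega
      rw [hdiv, hmod, dist_self]
      push_cast
      have hs := dist_triangle_right (p (L * (n / L))) (s (n + 1)) (p (n + 1))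
      rw [dist_comm (s (n + 1)) (p (n + 1))] at hs
      have hc : 0 ≤ D + ((L : ℝ) - 1 - (n % L : ℕ)) := by linarith
      nlinarith [mul_le_mul_of_nonneg_left htri hc, mul_nonneg hr0 hδ]

/-- The movement part of the cost is at most the total cost. -/
theorem mul_sum_dist_le_pmCost {X : Type*} [MetricSpace X] (D : ℝ) (n : ℕ) (a s : ℕ → X) :
    D * ∑ i ∈ Finset.Icc 1 n, dist (a (i - 1)) (a i) ≤ pmCost D n a s := by
  rw [pmCost, Finset.mul_sum]
  exact Finset.sum_le_sum fun i _ => le_add_of_nonneg_right dist_nonneg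

/-- For any position sequence `p`, the lazy sequence
`p' t = p (L·⌊t/L⌋)`, which only changes position at multiples of `L` (moving then to where
`p` currently is), satisfies `cost(p', s) ≤ cost(p, s) + L·∑ᵢ d(p(i−1), p(i))`, and in
particular `cost(p', s) ≤ (1 + L/D)·cost(p, s)`. -/
theorem stmt3 {X : Type*} [MetricSpace X] (D : ℝ) (hD : 1 ≤ D) (p₀ : X) (n : ℕ)
    (L : ℕ) (hL : 0 < L) (s p : ℕ → X) (hp0 : p 0 = p₀) :
    pmCost D n (fun t => p (L * (t / L))) s ≤
        pmCost D n p s + L * ∑ i ∈ Finset.Icc 1 n, dist (p (i - 1)) (p i) ∧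
      pmCost D n (fun t => p (L * (t / L))) s ≤ (1 + (L : ℝ) / D) * pmCost D n p s := by
  have hD0 : 0 < D := by linarith
  have hmain : pmCost D n (fun t => p (L * (t / L))) s ≤
      pmCost D n p s + L * ∑ i ∈ Finset.Icc 1 n, dist (p (i - 1)) (p i) := by
    have hr : ((n % L : ℕ) : ℝ) + 1 ≤ L := by exact_mod_cast Nat.mod_lt n hL
    have hpot : 0 ≤ (D + ((L : ℝ) - 1 - (n % L : ℕ))) * dist (p (L * (n / L))) (p n) :=
      mul_nonneg (by linarith) dist_nonneg
    linarith [pmCost_lazy_add_potential_le hD0.le n hL s p]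
  refine ⟨hmain, hmain.trans ?_⟩
  have hmove : (L : ℝ) / D * (D * ∑ i ∈ Finset.Icc 1 n, dist (p (i - 1)) (p i)) ≤
      (L : ℝ) / D * pmCost D n p s :=
    mul_le_mul_of_nonneg_left (mul_sum_dist_le_pmCost D n p s) (by positivity)
  rw [← mul_assoc, div_mul_cancel₀ _ hD0.ne'] at hmove
  linarith
end

section
/- Let L be a positive integer and let s be a request sequence. Then the infimum of cost(b, s) over all position sequences b that change position only at time steps that are multiples of L (i.e., b(t) = b(t−1) whenever t is not a multiple of L) is at most (1 + L/D) times OPT(s), the infimum of cost(b, s) over all position sequences b. -/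
open Finset

theorem pmCost_succ {X : Type*} [MetricSpace X] (D : ℝ) (n : ℕ) (a s : ℕ → X) :
    pmCost D (n + 1) a s =
      pmCost D n a s + (D * dist (a n) (a (n + 1)) + dist (a (n + 1)) (s (n + 1))) := by
  simp [pmCost, Finset.sum_Icc_succ_top]

/-- Sampling `b` at the last multiple of `L` costs at most a factor `1 + L / D`, even after adding
a potential proportional to the current distance between the sampled sequence and `b`. -/
theorem pmCost_sample_add_potential_le {X : Type*} [MetricSpace X] {D : ℝ} (hD : 0 < D)
    {L : ℕ} (hL : 0 < L) (b s : ℕ → X) (n : ℕ) :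
    pmCost D n (fun t => b (L * (t / L))) s
        + (D + L - 1 - (n % L : ℕ)) * dist (b (L * (n / L))) (b n) ≤
      (1 + (L : ℝ) / D) * pmCost D n b s := by
  induction n with
  | zero => simp [pmCost]
  | succ n ih =>
    rw [pmCost_succ, pmCost_succ, mul_add]
    have hstep : (D + L) * dist (b n) (b (n + 1)) + dist (b (n + 1)) (s (n + 1)) ≤
        (1 + (L : ℝ) / D) * (D * dist (b n) (b (n + 1)) + dist (b (n + 1)) (s (n + 1))) := by
      have h : (1 + (L : ℝ) / D) * D = D + L := by field_simp
      have h' : 0 ≤ (L : ℝ) / D * dist (b (n + 1)) (s (n + 1)) := by positivity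
      rw [mul_add, ← mul_assoc, h]
      linarith
    have hmove := dist_triangle (b (L * (n / L))) (b n) (b (n + 1))
    have hδ : 0 ≤ dist (b n) (b (n + 1)) := dist_nonneg
    by_cases hdvd : L ∣ n + 1
    · have hmod : (n % L : ℕ) + 1 = L := by
        obtain ⟨k, hk⟩ := hdvd
        obtain ⟨k, rfl⟩ : ∃ j, k = j + 1 := Nat.exists_eq_succ_of_ne_zero (by rintro rfl; simp at hk)
        have hn : n = L - 1 + L * k := by rw [mul_add] at hk; omega
        rw [hn, Nat.add_mul_mod_self_left, Nat.mod_eq_of_lt (by omega)]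
        omega
      have hmod' : ((n % L : ℕ) : ℝ) + 1 = L := by exact_mod_cast hmod
      have hcoef : D + (L : ℝ) - 1 - (n % L : ℕ) = D := by linarith
      rw [hcoef] at ih
      simp only [Nat.mul_div_cancel' hdvd, dist_self, mul_zero, add_zero]
      have hDmove := mul_le_mul_of_nonneg_left hmove hD.le
      have hLδ : 0 ≤ (L : ℝ) * dist (b n) (b (n + 1)) := by positivity
      linarith
    · have hdiv : (n + 1) / L = n / L := by simp [Nat.succ_div, hdvd]
      have hmod : (n + 1) % L = n % L + 1 := by
        have h₁ := Nat.div_add_mod (n + 1) L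
        have h₂ := Nat.div_add_mod n L
        rw [hdiv] at h₁
        omega
      have hlt : ((n % L : ℕ) : ℝ) + 1 ≤ L := by exact_mod_cast Nat.mod_lt n hL
      have hserve := dist_triangle (b (L * (n / L))) (b (n + 1)) (s (n + 1))
      have hpot : (D + (L : ℝ) - 1 - (n % L : ℕ)) * dist (b (L * (n / L))) (b (n + 1)) ≤
          (D + (L : ℝ) - 1 - (n % L : ℕ)) *
            (dist (b (L * (n / L))) (b n) + dist (b n) (b (n + 1))) :=
        mul_le_mul_of_nonneg_left hmove (by linarith)
      have hmodδ : 0 ≤ (1 + ((n % L : ℕ) : ℝ)) * dist (b n) (b (n + 1)) := by positivity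
      simp only [hdiv, hmod, dist_self, mul_zero, zero_add]
      push_cast
      linarith

theorem pmCost_sample_le {X : Type*} [MetricSpace X] {D : ℝ} (hD : 0 < D)
    {L : ℕ} (hL : 0 < L) (b s : ℕ → X) (n : ℕ) :
    pmCost D n (fun t => b (L * (t / L))) s ≤ (1 + (L : ℝ) / D) * pmCost D n b s := by
  have hlt : ((n % L : ℕ) : ℝ) + 1 ≤ L := by exact_mod_cast Nat.mod_lt n hL
  have hpot : 0 ≤ (D + L - 1 - (n % L : ℕ)) * dist (b (L * (n / L))) (b n) :=
    mul_nonneg (by linarith) dist_nonneg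
  linarith [pmCost_sample_add_potential_le hD hL b s n]

/-- The infimum of `cost(b, s)` over position sequences `b` that change
position only at time steps that are multiples of `L` is at most `(1 + L/D)·OPT(s)`. -/
theorem stmt4 {X : Type*} [MetricSpace X] (D : ℝ) (hD : 1 ≤ D) (p₀ : X) (n : ℕ)
    (L : ℕ) (hL : 0 < L) (s : ℕ → X) :
    sInf {c : ℝ | ∃ b : ℕ → X, b 0 = p₀ ∧
        (∀ t : ℕ, 1 ≤ t → ¬ (L ∣ t) → b t = b (t - 1)) ∧ pmCost D n b s = c} ≤
      (1 + (L : ℝ) / D) * pmOPT D p₀ n s := by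
  have hD₀ : 0 < D := by linarith
  have hfactor : 0 < 1 + (L : ℝ) / D := by positivity
  rw [← div_le_iff₀' hfactor]
  refine le_csInf ⟨_, fun _ => p₀, rfl, rfl⟩ ?_
  rintro _ ⟨b, hb, rfl⟩
  rw [div_le_iff₀' hfactor]
  refine le_trans (csInf_le ⟨0, ?_⟩ ?_) (pmCost_sample_le hD₀ hL b s n)
  · rintro _ ⟨a, -, -, rfl⟩
    exact pmCost_nonneg hD₀.le n a s
  · refine ⟨fun t => b (L * (t / L)), by simpa using hb, ?_, rfl⟩
    rintro (_ | t) ht hdvd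
    · omega
    · simp [Nat.succ_div, hdvd]
end

section
/- Let k be a positive integer, let s be a request sequence, and let p be any position sequence. Define the delayed position sequence p' by p'(t) = p(max(t−k, 0)) for all t ∈ {0,…,n}, i.e., p' follows p with a delay of k steps. Then cost(p', s) ≤ cost(p, s) + k·Σ_{i=1}^n d(p(i−1), p(i)); in particular cost(p', s) ≤ (1 + k/D)·cost(p, s), so for k = 6qD (when 6qD is a positive integer) the delayed sequence satisfies cost(p', s) ≤ (1+6q)·cost(p, s). -/
open Finset

/-- Delaying a sequence by one step does not increase the total movement. -/
theorem sum_dist_delay_one_le {X : Type*} [MetricSpace X] (n : ℕ) (a : ℕ → X) :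
    ∑ t ∈ Finset.Icc 1 n, dist (a (t - 1 - 1)) (a (t - 1)) ≤
      ∑ t ∈ Finset.Icc 1 n, dist (a (t - 1)) (a t) := by
  have key : ∀ m : ℕ, ∑ t ∈ Finset.Icc 1 m, dist (a (t - 1 - 1)) (a (t - 1)) +
      dist (a (m - 1)) (a m) = ∑ t ∈ Finset.Icc 1 m, dist (a (t - 1)) (a t) := by
    intro m
    induction m with
    | zero => simp
    | succ m ih =>
      rw [Finset.sum_Icc_succ_top (by lia), Finset.sum_Icc_succ_top (by lia), ← ih]
      simp only [Nat.add_sub_cancel]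
  linarith [key n, dist_nonneg (x := a (n - 1)) (y := a n)]

/-- Delaying a sequence by `k` steps does not increase the total movement. -/
theorem sum_dist_delay_le {X : Type*} [MetricSpace X] (n k : ℕ) (a : ℕ → X) :
    ∑ t ∈ Finset.Icc 1 n, dist (a (t - 1 - k)) (a (t - k)) ≤
      ∑ t ∈ Finset.Icc 1 n, dist (a (t - 1)) (a t) := by
  induction k with
  | zero => simp
  | succ k ih =>
    refine le_trans (le_of_eq ?_) ((sum_dist_delay_one_le n fun t => a (t - k)).trans ih)
    refine Finset.sum_congr rfl fun t _ => ?_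
    simp only [Nat.sub_sub, Nat.add_comm, Nat.add_left_comm]

/-- Delaying by one step increases the cost by at most the total movement. -/
theorem pmCost_delay_one_le {X : Type*} [MetricSpace X] (D : ℝ) (hD : 0 ≤ D) (n : ℕ)
    (a s : ℕ → X) :
    pmCost D n (fun t => a (t - 1)) s ≤
      pmCost D n a s + ∑ i ∈ Finset.Icc 1 n, dist (a (i - 1)) (a i) := by
  have hmove := mul_le_mul_of_nonneg_left (sum_dist_delay_one_le n a) hD
  have hserve : ∑ t ∈ Finset.Icc 1 n, dist (a (t - 1)) (s t) ≤
      ∑ t ∈ Finset.Icc 1 n, dist (a (t - 1)) (a t) + ∑ t ∈ Finset.Icc 1 n, dist (a t) (s t) := by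
    rw [← Finset.sum_add_distrib]
    exact Finset.sum_le_sum fun t _ => dist_triangle _ _ _
  simp only [pmCost, Finset.sum_add_distrib, ← Finset.mul_sum]
  linarith

/-- Delaying by `k` steps increases the cost by at most `k` times the total movement. -/
theorem pmCost_delay_le {X : Type*} [MetricSpace X] (D : ℝ) (hD : 0 ≤ D) (n k : ℕ)
    (a s : ℕ → X) :
    pmCost D n (fun t => a (t - k)) s ≤
      pmCost D n a s + k * ∑ i ∈ Finset.Icc 1 n, dist (a (i - 1)) (a i) := by
  induction k with
  | zero => simp
  | succ k ih =>
    have hstep := pmCost_delay_one_le D hD n (fun t => a (t - k)) s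
    have hmove := sum_dist_delay_le n k a
    simp only [Nat.sub_sub, Nat.add_comm 1 k] at hstep hmove ⊢
    push_cast
    linarith

/-- For any position sequence `p`, the delayed sequence
`p' t = p (max (t − k) 0)` (here `t - k` is truncated subtraction on `ℕ`) satisfies
`cost(p', s) ≤ cost(p, s) + k·∑ᵢ d(p(i−1), p(i))`, in particular
`cost(p', s) ≤ (1 + k/D)·cost(p, s)`; so if `k = 6qD` then
`cost(p', s) ≤ (1 + 6q)·cost(p, s)`. -/
theorem stmt5 {X : Type*} [MetricSpace X] (D : ℝ) (hD : 1 ≤ D) (p₀ : X) (n : ℕ)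
    (k : ℕ) (hk : 0 < k) (s p : ℕ → X) (hp0 : p 0 = p₀) :
    pmCost D n (fun t => p (t - k)) s ≤
        pmCost D n p s + k * ∑ i ∈ Finset.Icc 1 n, dist (p (i - 1)) (p i) ∧
      pmCost D n (fun t => p (t - k)) s ≤ (1 + (k : ℝ) / D) * pmCost D n p s ∧
      ∀ q : ℝ, (k : ℝ) = 6 * q * D →
        pmCost D n (fun t => p (t - k)) s ≤ (1 + 6 * q) * pmCost D n p s := by
  have hD0 : 0 < D := by linarith
  have hdelay := pmCost_delay_le D hD0.le n k p s
  have hratio : pmCost D n (fun t => p (t - k)) s ≤ (1 + (k : ℝ) / D) * pmCost D n p s := by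
    have hmove := mul_le_mul_of_nonneg_left (mul_sum_dist_le_pmCost D n p s)
      (show 0 ≤ (k : ℝ) / D by positivity)
    rw [← mul_assoc, div_mul_cancel₀ _ hD0.ne'] at hmove
    linarith
  refine ⟨hdelay, hratio, fun q hq => ?_⟩
  rwa [hq, mul_div_cancel_right₀ _ hD0.ne'] at hratio
end

section
/- Let q ∈ (0, 1/24), let s and ŝ be request sequences whose total number of mismatches satisfies m({1,…,n}) ≤ 2qD, and let a be a position sequence satisfying cost(a, ŝ) ≤ cost(b, ŝ) for every position sequence b (an optimal offline solution for ŝ). Then for every t ∈ {0,…,n} it holds that qD·d(a(t), p₀) ≤ OPT(s). -/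
open Finset

lemma dist_zero_le_sum_Icc {X : Type*} [MetricSpace X] (a : ℕ → X) {n t : ℕ} (ht : t ≤ n) :
    dist (a t) (a 0) ≤ ∑ i ∈ Finset.Icc 1 n, dist (a (i - 1)) (a i) := by
  refine le_trans ?_ (Finset.sum_le_sum_of_subset_of_nonneg
    (Finset.Icc_subset_Icc_right ht) fun _ _ _ => dist_nonneg)
  clear ht
  induction t with
  | zero => simp
  | succ k ih =>
    rw [Finset.sum_Icc_succ_top (by omega), Nat.add_sub_cancel]
    linarith [dist_triangle (a (k + 1)) (a k) (a 0), dist_comm (a (k + 1)) (a k)]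

lemma pmCost_eq_add {X : Type*} [MetricSpace X] (D : ℝ) (n : ℕ) (a s : ℕ → X) :
    pmCost D n a s = D * ∑ i ∈ Finset.Icc 1 n, dist (a (i - 1)) (a i) +
      ∑ i ∈ Finset.Icc 1 n, dist (a i) (s i) := by
  rw [pmCost, Finset.sum_add_distrib, Finset.mul_sum]

/-- Serving mismatched requests from `b` instead of `a` costs at most `K` more per mismatch,
where `K` bounds the distance between `a` and `b`. -/
lemma sum_dist_le_add_mismatches {X : Type*} [MetricSpace X] (a b s shat : ℕ → X)
    (I : Finset ℕ) (K : ℝ) (hK : ∀ i ∈ I, dist (b i) (a i) ≤ K) :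
    ∑ i ∈ I, dist (b i) (shat i) ≤
      ∑ i ∈ I, dist (b i) (s i) + ∑ i ∈ I, dist (a i) (shat i) + mismatches s shat I * K := by
  classical
  have hcount : (mismatches s shat I : ℝ) * K =
      ∑ i ∈ I, if s i ≠ shat i then K else 0 := by
    rw [← Finset.sum_filter, Finset.sum_const, nsmul_eq_mul, mismatches]
  rw [hcount, ← Finset.sum_add_distrib, ← Finset.sum_add_distrib]
  refine Finset.sum_le_sum fun i hi => ?_
  split_ifs with h
  · linarith [hK i hi, dist_triangle (b i) (a i) (shat i), dist_nonneg (x := b i) (y := s i)]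
  · rw [not_not.mp h]
    linarith [dist_nonneg (x := a i) (y := shat i)]

/-- Let `q ∈ (0, 1/24)`, let `s`, `ŝ` have at most `2qD` mismatches in total,
and let `a` be an optimal offline position sequence for `ŝ`. Then for every `t ∈ {0,…,n}`,
`qD·d(a t, p₀) ≤ OPT(s)`. -/
theorem stmt7 {X : Type*} [MetricSpace X] (D : ℝ) (hD : 1 ≤ D) (p₀ : X) (n : ℕ)
    (q : ℝ) (hq0 : 0 < q) (hq1 : q < 1 / 24)
    (s shat : ℕ → X)
    (hm : (mismatches s shat (Finset.Icc 1 n) : ℝ) ≤ 2 * q * D)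
    (a : ℕ → X) (ha0 : a 0 = p₀)
    (haopt : ∀ b : ℕ → X, b 0 = p₀ → pmCost D n a shat ≤ pmCost D n b shat)
    (t : ℕ) (ht : t ≤ n) :
    q * D * dist (a t) p₀ ≤ pmOPT D p₀ n s := by
  refine le_csInf ⟨_, a, ha0, rfl⟩ ?_
  rintro c ⟨b, hb0, rfl⟩
  have hopt := haopt b hb0
  have ha := fun i (hi : i ≤ n) => dist_zero_le_sum_Icc a hi
  have hb := fun i (hi : i ≤ n) => dist_zero_le_sum_Icc b hi
  have hat := ha t ht
  have hswitch := sum_dist_le_add_mismatches a b s shat (Finset.Icc 1 n)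
    (∑ i ∈ Finset.Icc 1 n, dist (a (i - 1)) (a i) +
      ∑ i ∈ Finset.Icc 1 n, dist (b (i - 1)) (b i)) fun i hi => by
        have hin := (Finset.mem_Icc.mp hi).2
        have hai := ha i hin
        have hbi := hb i hin
        rw [ha0] at hai
        rw [hb0] at hbi
        linarith [dist_triangle_right (b i) (a i) p₀]
  rw [pmCost_eq_add, pmCost_eq_add] at hopt
  rw [pmCost_eq_add]
  rw [ha0] at hat
  have hS : 0 ≤ ∑ i ∈ Finset.Icc 1 n, dist (b i) (s i) :=
    Finset.sum_nonneg fun _ _ => dist_nonneg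
  have hM : 0 ≤ ∑ i ∈ Finset.Icc 1 n, dist (a (i - 1)) (a i) :=
    Finset.sum_nonneg fun _ _ => dist_nonneg
  have hB : 0 ≤ ∑ i ∈ Finset.Icc 1 n, dist (b (i - 1)) (b i) :=
    Finset.sum_nonneg fun _ _ => dist_nonneg
  generalize (∑ i ∈ Finset.Icc 1 n, dist (a (i - 1)) (a i)) = M at *
  generalize (∑ i ∈ Finset.Icc 1 n, dist (b (i - 1)) (b i)) = B at *
  generalize (∑ i ∈ Finset.Icc 1 n, dist (b i) (s i)) = S at *
  have hmis := mul_le_mul_of_nonneg_right hm (add_nonneg hM hB)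
  have hDM : 0 ≤ D * M := by positivity
  have hDB : 0 ≤ D * B := by positivity
  have hdist : q * D * dist (a t) p₀ ≤ q * D * M :=
    mul_le_mul_of_nonneg_left hat (by positivity)
  have hmain : D * M ≤ D * B + S + 2 * q * (D * M) + 2 * q * (D * B) := by linarith
  have hqM : q * (D * M) ≤ 1 / 24 * (D * M) := mul_le_mul_of_nonneg_right hq1.le hDM
  have hqB : q * (D * B) ≤ 1 / 24 * (D * B) := mul_le_mul_of_nonneg_right hq1.le hDB
  linarith
end

section
/- Let r ≥ 0 be a real number, let k be a positive integer with k ≤ D, and let s be a request sequence containing at least k indices t ∈ {1,…,n} with d(s(t), p₀) ≥ r. Then every position sequence o satisfies cost(o, s) ≥ k·r; in particular OPT(s) ≥ k·r. -/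
open Finset

/-- The displacement of a trajectory from its start is at most its path length. -/
lemma dist_zero_le_sum_Icc_dist {X : Type*} [PseudoMetricSpace X] (a : ℕ → X) {t n : ℕ}
    (htn : t ≤ n) : dist (a t) (a 0) ≤ ∑ i ∈ Finset.Icc 1 n, dist (a (i - 1)) (a i) := by
  have hpath : dist (a 0) (a t) ≤ ∑ i ∈ Finset.Icc 1 t, dist (a (i - 1)) (a i) := by
    induction t with
    | zero => simp
    | succ t ih =>
      rw [Finset.sum_Icc_succ_top (by omega), Nat.add_sub_cancel]
      linarith [ih (by omega), dist_triangle (a 0) (a t) (a (t + 1))]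
  rw [dist_comm]
  exact hpath.trans (Finset.sum_le_sum_of_subset_of_nonneg (Finset.Icc_subset_Icc_right htn)
    fun _ _ _ => dist_nonneg)

lemma mul_le_pmCost {X : Type*} [MetricSpace X] {D : ℝ} {n k : ℕ} {r : ℝ} (hkD : (k : ℝ) ≤ D)
    {s o : ℕ → X}
    (hs : k ≤ ((Finset.Icc 1 n).filter fun t => r ≤ dist (s t) (o 0)).card) :
    (k : ℝ) * r ≤ pmCost D n o s := by
  obtain ⟨S, hS, rfl⟩ := Finset.exists_subset_card_eq hs
  set M := ∑ i ∈ Finset.Icc 1 n, dist (o (i - 1)) (o i) with hM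
  have hM0 : 0 ≤ M := Finset.sum_nonneg fun _ _ => dist_nonneg
  have hservice : (S.card : ℝ) * (r - M) ≤ ∑ t ∈ Finset.Icc 1 n, dist (o t) (s t) := by
    rw [← nsmul_eq_mul]
    refine (Finset.card_nsmul_le_sum S (fun t => dist (o t) (s t)) _ fun t ht => ?_).trans
      (Finset.sum_le_sum_of_subset_of_nonneg (hS.trans (Finset.filter_subset _ _))
        fun _ _ _ => dist_nonneg)
    obtain ⟨htn, hfar⟩ := Finset.mem_filter.1 (hS ht)
    have hpath := dist_zero_le_sum_Icc_dist o (Finset.mem_Icc.1 htn).2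
    linarith [dist_triangle_left (s t) (o 0) (o t)]
  rw [pmCost, Finset.sum_add_distrib, ← Finset.mul_sum, ← hM]
  linarith [mul_le_mul_of_nonneg_right hkD hM0]

/-- If `r ≥ 0`, `k` is a positive integer with `k ≤ D`, and the request
sequence `s` contains at least `k` indices `t ∈ {1,…,n}` with `d(s t, p₀) ≥ r`, then every
position sequence `o` has `cost(o, s) ≥ k·r`; in particular `OPT(s) ≥ k·r`. -/
theorem stmt8 {X : Type*} [MetricSpace X] (D : ℝ) (hD : 1 ≤ D) (p₀ : X) (n : ℕ)
    (r : ℝ) (hr : 0 ≤ r) (k : ℕ) (hk : 0 < k) (hkD : (k : ℝ) ≤ D)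
    (s : ℕ → X)
    (hs : k ≤ ((Finset.Icc 1 n).filter fun t => r ≤ dist (s t) p₀).card) :
    (∀ o : ℕ → X, o 0 = p₀ → (k : ℝ) * r ≤ pmCost D n o s) ∧
      (k : ℝ) * r ≤ pmOPT D p₀ n s := by
  have hcost : ∀ o : ℕ → X, o 0 = p₀ → (k : ℝ) * r ≤ pmCost D n o s := by
    rintro o rfl
    exact mul_le_pmCost hkD hs
  refine ⟨hcost, le_csInf ⟨_, fun _ => p₀, rfl, rfl⟩ ?_⟩
  rintro _ ⟨b, hb, rfl⟩
  exact hcost b hb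
end

section
/- Let s and ŝ be request sequences and let a and o be position sequences with cost(a, ŝ) ≤ cost(o, ŝ). Let 0 = t₀ < t₁ < … < t_k = n be time steps such that a and o are both constant on each interval {t_{i−1}+1,…,t_i} (i.e., a(t) = a(t_i) and o(t) = o(t_i) for all t_{i−1} < t ≤ t_i). For each i let c_i = D·(d(a(t_{i−1}), a(t_i)) + d(o(t_{i−1}), o(t_i))). Then cost(a, s) − cost(o, s) ≤ 2·Σ_{i=1}^k m({t_{i−1}+1,…,t_i}) · (cost_{t_i}(a,s) − cost_{t_{i−1}}(a,s) + cost_{t_i}(o,s) − cost_{t_{i−1}}(o,s) − c_i) / (t_i − t_{i−1}). -/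
open Finset

/-- Cost increment over an interval `(p, q]` on which the positions are constant. -/
theorem pmCost_of_const {X : Type*} [MetricSpace X] (D : ℝ) (a s : ℕ → X) (A : X) {p q : ℕ}
    (hpq : p < q) (h : ∀ u, p < u → u ≤ q → a u = A) :
    pmCost D q a s = pmCost D p a s + D * dist (a p) A +
      ∑ u ∈ Finset.Icc (p + 1) q, dist A (s u) := by
  induction q, hpq using Nat.le_induction with
  | base =>
    rw [Nat.succ_eq_add_one, pmCost_succ, h (p + 1) (by lia) le_rfl]
    simp [add_assoc]
  | succ q hq ih =>
    rw [pmCost_succ, ih fun u hu huq => h u hu (by lia), Finset.sum_Icc_succ_top (by lia),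
      h (q + 1) (by lia) le_rfl, h q (by lia) (by lia), dist_self]
    ring

/-- Replacing `shat` by `s` changes the service-cost difference between the points `A` and `O` by
at most `2 * dist A O` per mismatch. -/
theorem sum_dist_sub_le_mismatches {X : Type*} [MetricSpace X] (s shat : ℕ → X) (A O : X)
    (I : Finset ℕ) :
    ∑ u ∈ I, dist A (s u) - ∑ u ∈ I, dist A (shat u) -
        (∑ u ∈ I, dist O (s u) - ∑ u ∈ I, dist O (shat u)) ≤
      2 * ((mismatches s shat I : ℝ) * dist A O) := by
  classical
  have hm : (mismatches s shat I : ℝ) = ∑ u ∈ I, if s u ≠ shat u then (1 : ℝ) else 0 := by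
    rw [Finset.sum_boole, mismatches]
  rw [hm, Finset.sum_mul, Finset.mul_sum, ← Finset.sum_sub_distrib, ← Finset.sum_sub_distrib,
    ← Finset.sum_sub_distrib]
  refine Finset.sum_le_sum fun u _ => ?_
  by_cases hu : s u = shat u
  · simp [hu]
  · have h₁ := dist_triangle A O (s u)
    have h₂ := dist_triangle_left O (shat u) A
    rw [if_pos hu]
    linarith

/-- The distance of two points is at most the average sum of distances to the requests. -/
theorem dist_le_average {X : Type*} [MetricSpace X] (s : ℕ → X) (A O : X) {p q : ℕ}
    (hpq : p < q) :
    dist A O ≤ (∑ u ∈ Finset.Icc (p + 1) q, dist A (s u) +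
      ∑ u ∈ Finset.Icc (p + 1) q, dist O (s u)) / ((q : ℝ) - (p : ℝ)) := by
  have hpos : (0 : ℝ) < (q : ℝ) - p := sub_pos.2 (by exact_mod_cast hpq)
  have h := Finset.card_nsmul_le_sum (Finset.Icc (p + 1) q)
    (fun u => dist A (s u) + dist O (s u)) (dist A O) fun u _ => dist_triangle_right A O (s u)
  rw [Nat.card_Icc, Nat.add_sub_add_right, nsmul_eq_mul, Nat.cast_sub hpq.le,
    Finset.sum_add_distrib] at h
  rw [le_div_iff₀ hpos]
  linarith

/-- Let `a`, `o` be position sequences with `cost(a, ŝ) ≤ cost(o, ŝ)`, and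
let `0 = t 0 < t 1 < … < t k = n` be times such that `a` and `o` are constant on each interval
`{t(i−1)+1, …, t i}`. With `cᵢ = D·(d(a(t(i−1)), a(t i)) + d(o(t(i−1)), o(t i)))`,
`cost(a,s) − cost(o,s) ≤ 2·∑ᵢ m((t(i−1), t i]) · (Δᵢcost(a,s) + Δᵢcost(o,s) − cᵢ)/(t i − t(i−1))`,
where `Δᵢ` denotes the increment of the partial cost over `(t(i−1), t i]`. -/
theorem stmt9 {X : Type*} [MetricSpace X] (D : ℝ) (hD : 1 ≤ D) (p₀ : X) (n : ℕ)
    (s shat : ℕ → X) (a o : ℕ → X) (ha0 : a 0 = p₀) (ho0 : o 0 = p₀)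
    (hopt : pmCost D n a shat ≤ pmCost D n o shat)
    (k : ℕ) (hk : 0 < k) (t : ℕ → ℕ) (ht0 : t 0 = 0) (htk : t k = n)
    (hmono : ∀ i < k, t i < t (i + 1))
    (hconst : ∀ i ∈ Finset.Icc 1 k, ∀ u : ℕ, t (i - 1) < u → u ≤ t i →
      a u = a (t i) ∧ o u = o (t i)) :
    pmCost D n a s - pmCost D n o s ≤
      2 * ∑ i ∈ Finset.Icc 1 k,
        (mismatches s shat (Finset.Icc (t (i - 1) + 1) (t i)) : ℝ) *
          ((pmCost D (t i) a s - pmCost D (t (i - 1)) a s +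
              (pmCost D (t i) o s - pmCost D (t (i - 1)) o s) -
              D * (dist (a (t (i - 1))) (a (t i)) + dist (o (t (i - 1))) (o (t i)))) /
            ((t i : ℝ) - (t (i - 1) : ℝ))) := by
  suffices key : ∀ j ≤ k,
      pmCost D (t j) a s - pmCost D (t j) a shat -
          (pmCost D (t j) o s - pmCost D (t j) o shat) ≤
        2 * ∑ i ∈ Finset.Icc 1 j,
          (mismatches s shat (Finset.Icc (t (i - 1) + 1) (t i)) : ℝ) *
            ((pmCost D (t i) a s - pmCost D (t (i - 1)) a s +
                (pmCost D (t i) o s - pmCost D (t (i - 1)) o s) -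
                D * (dist (a (t (i - 1))) (a (t i)) + dist (o (t (i - 1))) (o (t i)))) /
              ((t i : ℝ) - (t (i - 1) : ℝ))) by
    have h := key k le_rfl
    rw [htk] at h
    linarith
  intro j
  induction j with
  | zero => simp [ht0, pmCost]
  | succ j ih =>
    intro hj
    have hlt : t j < t (j + 1) := hmono j hj
    have hc := hconst (j + 1) (by simp; lia)
    rw [Nat.add_sub_cancel] at hc
    have hA (r : ℕ → X) := pmCost_of_const D a r (a (t (j + 1))) hlt fun u h₁ h₂ => (hc u h₁ h₂).1
    have hO (r : ℕ → X) := pmCost_of_const D o r (o (t (j + 1))) hlt fun u h₁ h₂ => (hc u h₁ h₂).2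
    have hdist := mul_le_mul_of_nonneg_left
      (dist_le_average s (a (t (j + 1))) (o (t (j + 1))) hlt)
      (Nat.cast_nonneg (α := ℝ) (mismatches s shat (Finset.Icc (t j + 1) (t (j + 1)))))
    have hsum := sum_dist_sub_le_mismatches s shat (a (t (j + 1))) (o (t (j + 1)))
      (Finset.Icc (t j + 1) (t (j + 1)))
    have hnum : pmCost D (t (j + 1)) a s - pmCost D (t j) a s +
          (pmCost D (t (j + 1)) o s - pmCost D (t j) o s) -
          D * (dist (a (t j)) (a (t (j + 1))) + dist (o (t j)) (o (t (j + 1)))) =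
        ∑ u ∈ Finset.Icc (t j + 1) (t (j + 1)), dist (a (t (j + 1))) (s u) +
          ∑ u ∈ Finset.Icc (t j + 1) (t (j + 1)), dist (o (t (j + 1))) (s u) := by
      rw [hA s, hO s]
      ring
    rw [Finset.sum_Icc_succ_top (by lia), Nat.add_sub_cancel, hnum, hA s, hA shat, hO s, hO shat]
    have := ih (by lia)
    linarith
end

section
/- Let L be a positive integer with n a multiple of L, let q ≥ 0, and let s and ŝ be request sequences with m({(j−1)L+1,…,jL}) ≤ qL for every block j = 1,…,n/L. Let a and o be position sequences that are each constant on every block {(j−1)L+1,…,jL}, and suppose cost(a, ŝ) ≤ cost(o, ŝ). Then cost(a, s) − cost(o, s) ≤ 2q·(cost(a, s) + cost(o, s)). -/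
open Finset

/-- Two sums over `{1, …, kL}` compare if they compare on each block `{(j-1)L+1, …, jL}`. -/
theorem sum_Icc_mul_le_of_blocks (L k : ℕ) (f g : ℕ → ℝ)
    (h : ∀ j ∈ Finset.Icc 1 k,
      ∑ t ∈ Finset.Icc ((j - 1) * L + 1) (j * L), f t ≤
        ∑ t ∈ Finset.Icc ((j - 1) * L + 1) (j * L), g t) :
    ∑ t ∈ Finset.Icc 1 (k * L), f t ≤ ∑ t ∈ Finset.Icc 1 (k * L), g t := by
  induction k with
  | zero => simp
  | succ k ih =>
    have hsplit : Finset.Icc 1 ((k + 1) * L) =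
        Finset.Icc 1 (k * L) ∪ Finset.Icc (k * L + 1) ((k + 1) * L) := by
      ext t
      simp only [Finset.mem_union, Finset.mem_Icc]
      have := Nat.succ_mul k L
      grind
    have hdisj : Disjoint (Finset.Icc 1 (k * L)) (Finset.Icc (k * L + 1) ((k + 1) * L)) := by
      rw [Finset.disjoint_left]
      intro t
      simp only [Finset.mem_Icc]
      omega
    rw [hsplit, Finset.sum_union hdisj, Finset.sum_union hdisj]
    refine add_le_add (ih fun j hj => h j ?_) ?_
    · simp only [Finset.mem_Icc] at hj ⊢
      omega
    · simpa using h (k + 1) (by simp)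

open Classical in
/-- The difference of the service costs of two points changes by at most twice their distance
when the request changes. -/
theorem dist_sub_dist_change_le_ite {X : Type*} [MetricSpace X] (x y u v : X) :
    dist x u - dist x v - dist y u + dist y v ≤ if u ≠ v then 2 * dist x y else 0 := by
  split_ifs with huv
  · have h₁ := dist_triangle x y u
    have h₂ := dist_triangle_left y v x
    linarith
  · simp_all

/-- On a block of `L` steps with at most `qL` mismatches, the change in the difference of service
costs of two constant positions is at most `2qL` times their distance. -/
theorem sum_block_dist_change_le {X : Type*} [MetricSpace X] (s shat a o : ℕ → X) (I : Finset ℕ)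
    (q : ℝ) (hm : (mismatches s shat I : ℝ) ≤ q * I.card)
    (ha : ∀ t ∈ I, ∀ t' ∈ I, a t = a t') (ho : ∀ t ∈ I, ∀ t' ∈ I, o t = o t') :
    ∑ t ∈ I, (dist (a t) (s t) - dist (a t) (shat t) - dist (o t) (s t) + dist (o t) (shat t)) ≤
      ∑ t ∈ I, 2 * q * dist (a t) (o t) := by
  classical
  obtain rfl | ⟨r, hr⟩ := I.eq_empty_or_nonempty
  · simp
  calc _ ≤ ∑ t ∈ I, if s t ≠ shat t then 2 * dist (a r) (o r) else 0 :=
        Finset.sum_le_sum fun t ht => by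
          rw [ha t ht r hr, ho t ht r hr]
          convert dist_sub_dist_change_le_ite (a r) (o r) (s t) (shat t)
    _ = mismatches s shat I * (2 * dist (a r) (o r)) := by
        rw [← Finset.sum_filter, Finset.sum_const, nsmul_eq_mul]
        unfold mismatches
        congr!
    _ ≤ q * I.card * (2 * dist (a r) (o r)) := by gcongr
    _ = ∑ t ∈ I, 2 * q * dist (a r) (o r) := by
        rw [Finset.sum_const, nsmul_eq_mul]
        ring
    _ = _ := Finset.sum_congr rfl fun t ht => by rw [ha t ht r hr, ho t ht r hr]

/-- The sum of the distances between two position sequences is at most their total cost. -/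
theorem sum_dist_le_pmCost_add_pmCost {X : Type*} [MetricSpace X] {D : ℝ} (hD : 0 ≤ D) (n : ℕ)
    (a o s : ℕ → X) :
    ∑ t ∈ Finset.Icc 1 n, dist (a t) (o t) ≤ pmCost D n a s + pmCost D n o s := by
  unfold pmCost
  rw [← Finset.sum_add_distrib]
  refine Finset.sum_le_sum fun t _ => ?_
  have h₁ := dist_triangle_right (a t) (o t) (s t)
  have h₂ : 0 ≤ D * dist (a (t - 1)) (a t) := by positivity
  have h₃ : 0 ≤ D * dist (o (t - 1)) (o t) := by positivity
  linarith

/-- The change of the cost difference of two position sequences under a change of requests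
involves only the service costs. -/
theorem pmCost_sub_change_eq {X : Type*} [MetricSpace X] (D : ℝ) (n : ℕ) (a o s shat : ℕ → X) :
    pmCost D n a s - pmCost D n a shat - pmCost D n o s + pmCost D n o shat =
      ∑ t ∈ Finset.Icc 1 n, (dist (a t) (s t) - dist (a t) (shat t) - dist (o t) (s t) +
        dist (o t) (shat t)) := by
  unfold pmCost
  rw [← Finset.sum_sub_distrib, ← Finset.sum_sub_distrib, ← Finset.sum_add_distrib]
  exact Finset.sum_congr rfl fun t _ => by ring

/-- Let `n` be a multiple of `L`, `q ≥ 0`, and suppose each block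
`{(j−1)L+1,…,jL}` has at most `qL` mismatches between `s` and `ŝ`. If `a` and `o` are
position sequences, each constant on every block, with `cost(a, ŝ) ≤ cost(o, ŝ)`, then
`cost(a, s) − cost(o, s) ≤ 2q·(cost(a, s) + cost(o, s))`. -/
theorem stmt10 {X : Type*} [MetricSpace X] (D : ℝ) (hD : 1 ≤ D) (p₀ : X) (n L : ℕ)
    (hL : 0 < L) (hdvd : L ∣ n) (q : ℝ) (hq : 0 ≤ q)
    (s shat : ℕ → X)
    (hm : ∀ j ∈ Finset.Icc 1 (n / L),
      (mismatches s shat (Finset.Icc ((j - 1) * L + 1) (j * L)) : ℝ) ≤ q * L)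
    (a o : ℕ → X) (ha0 : a 0 = p₀) (ho0 : o 0 = p₀)
    (haB : BlockConst L n a) (hoB : BlockConst L n o)
    (hopt : pmCost D n a shat ≤ pmCost D n o shat) :
    pmCost D n a s - pmCost D n o s ≤ 2 * q * (pmCost D n a s + pmCost D n o s) := by
  obtain ⟨k, rfl⟩ := hdvd
  rw [Nat.mul_div_cancel_left k hL] at hm
  have hk : L * k / L = k := Nat.mul_div_cancel_left k hL
  have hblocks := sum_Icc_mul_le_of_blocks L k
    (fun t => dist (a t) (s t) - dist (a t) (shat t) - dist (o t) (s t) + dist (o t) (shat t))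
    (fun t => 2 * q * dist (a t) (o t)) fun j hj => by
      refine sum_block_dist_change_le s shat a o _ q ?_ (haB j (by rwa [hk])) (hoB j (by rwa [hk]))
      have hcard : (Finset.Icc ((j - 1) * L + 1) (j * L)).card = L := by
        obtain ⟨i, rfl⟩ := Nat.exists_eq_add_of_le' (Finset.mem_Icc.mp hj).1
        rw [Nat.card_Icc, Nat.add_sub_cancel, Nat.succ_mul]
        omega
      rw [hcard]
      exact hm j hj
  rw [mul_comm k L, ← pmCost_sub_change_eq D, ← Finset.mul_sum] at hblocks
  have hsum := mul_le_mul_of_nonneg_left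
    (sum_dist_le_pmCost_add_pmCost (zero_le_one.trans hD) (L * k) a o s)
    (mul_nonneg zero_le_two hq)
  linarith
end

section
/- Assume (X,d) is a uniform metric space (d(x,y) = 1 for all x ≠ y), D is a positive integer, q ≥ 0, and n ≥ D. Let s and ŝ be request sequences such that m(I) ≤ qD for every interval I ⊆ {1,…,n} of length D. Let a and o be position sequences with cost(a, ŝ) ≤ cost(o, ŝ). Then cost(a, s) − cost(o, s) ≤ 4q·(cost(a, s) + cost(o, s)). -/
open Finset

/-- If `f` is dominated by `q * g` on every window of length `D` in `{1, …, n}` and `D ≤ n`,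
then it is dominated by `2 * q * g` on the whole of `{1, …, n}`. -/
theorem sum_le_two_mul_of_window_sum_le {D n : ℕ} (hD : 0 < D) (hn : D ≤ n) {q : ℝ} (hq : 0 ≤ q)
    {f g : ℕ → ℝ} (hf : ∀ t, 0 ≤ f t) (hg : ∀ t, 0 ≤ g t)
    (h : ∀ i, i + D ≤ n → ∑ t ∈ Ioc i (i + D), f t ≤ q * ∑ t ∈ Ioc i (i + D), g t) :
    ∑ t ∈ Ioc 0 n, f t ≤ 2 * q * ∑ t ∈ Ioc 0 n, g t := by
  have blocks : ∀ k, k * D ≤ n →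
      ∑ t ∈ Ioc 0 (k * D), f t ≤ q * ∑ t ∈ Ioc 0 (k * D), g t := by
    intro k
    induction k with
    | zero => simp
    | succ k ih =>
      intro hk
      rw [Nat.succ_mul] at hk ⊢
      rw [← sum_Ioc_consecutive f (Nat.zero_le (k * D)) (Nat.le_add_right _ D),
        ← sum_Ioc_consecutive g (Nat.zero_le (k * D)) (Nat.le_add_right _ D), mul_add]
      exact add_le_add (ih (by omega)) (h _ hk)
  have hdiv : n / D * D ≤ n := Nat.div_mul_le_self n D
  have hlt : n < n / D * D + D := Nat.lt_div_mul_add hD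
  have last := h (n - D) (by omega)
  rw [Nat.sub_add_cancel hn] at last
  have hrest : ∑ t ∈ Ioc (n / D * D) n, f t ≤ ∑ t ∈ Ioc (n - D) n, f t :=
    sum_le_sum_of_subset_of_nonneg (Ioc_subset_Ioc_left (by omega)) fun t _ _ => hf t
  have hfirst_le : ∑ t ∈ Ioc 0 (n / D * D), g t ≤ ∑ t ∈ Ioc 0 n, g t :=
    sum_le_sum_of_subset_of_nonneg (Ioc_subset_Ioc_right hdiv) fun t _ _ => hg t
  have hlast_le : ∑ t ∈ Ioc (n - D) n, g t ≤ ∑ t ∈ Ioc 0 n, g t :=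
    sum_le_sum_of_subset_of_nonneg (Ioc_subset_Ioc_left (Nat.zero_le _)) fun t _ _ => hg t
  rw [← sum_Ioc_consecutive f (Nat.zero_le (n / D * D)) hdiv]
  have := blocks _ hdiv
  have := mul_le_mul_of_nonneg_left hfirst_le hq
  have := mul_le_mul_of_nonneg_left hlast_le hq
  linarith

/-- On a window of length `D`, two position sequences that are not equal throughout pay jointly
at least `D` in a uniform metric space. -/
theorem le_window_cost_of_exists_ne {X : Type*} [MetricSpace X]
    (huni : ∀ x y : X, x ≠ y → dist x y = 1) {D i : ℕ} {a o s : ℕ → X}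
    (hne : ∃ t ∈ Ioc i (i + D), a t ≠ o t) :
    (D : ℝ) ≤ ∑ t ∈ Ioc i (i + D),
      ((D * dist (a (t - 1)) (a t) + dist (a t) (s t)) +
        (D * dist (o (t - 1)) (o t) + dist (o t) (s t))) := by
  have hnonneg (b : ℕ → X) (t : ℕ) : 0 ≤ (D : ℝ) * dist (b (t - 1)) (b t) := by positivity
  by_cases hmove : ∃ t ∈ Ioc i (i + D), a (t - 1) ≠ a t ∨ o (t - 1) ≠ o t
  · obtain ⟨t, ht, hmv⟩ := hmove
    refine le_trans ?_ (single_le_sum (fun t _ => by positivity) ht)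
    have := hnonneg a t
    have := hnonneg o t
    have := dist_nonneg (x := a t) (y := s t)
    have := dist_nonneg (x := o t) (y := s t)
    rcases hmv with hmv | hmv
    · rw [huni _ _ hmv]
      linarith
    · rw [huni _ _ hmv]
      linarith
  · push Not at hmove
    have const : ∀ k ≤ D, a (i + k) = a i ∧ o (i + k) = o i := by
      intro k
      induction k with
      | zero => simp
      | succ k ih =>
        intro hk
        have hstep := hmove (i + (k + 1)) (by simp; omega)
        have hpos := ih (by omega)
        rw [show i + (k + 1) - 1 = i + k by omega] at hstep
        exact ⟨hstep.1.symm.trans hpos.1, hstep.2.symm.trans hpos.2⟩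
    have const' : ∀ t ∈ Ioc i (i + D), a t = a i ∧ o t = o i := by
      intro t ht
      rw [mem_Ioc] at ht
      have := const (t - i) (by omega)
      rwa [Nat.add_sub_cancel' ht.1.le] at this
    obtain ⟨t₀, ht₀, hne⟩ := hne
    rw [(const' t₀ ht₀).1, (const' t₀ ht₀).2] at hne
    calc (D : ℝ) = ∑ _t ∈ Ioc i (i + D), (1 : ℝ) := by simp
      _ ≤ _ := sum_le_sum fun t ht => by
        have htri := dist_triangle_right (a t) (o t) (s t)
        have hone : dist (a t) (o t) = 1 := by
          rw [(const' t ht).1, (const' t ht).2, huni _ _ hne]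
        have := hnonneg a t
        have := hnonneg o t
        linarith

/-- In a uniform metric space (`d(x,y) = 1` for `x ≠ y`), with `D` a
positive integer, `q ≥ 0`, `n ≥ D`, if every interval of length `D` has at most `qD`
mismatches between `s` and `ŝ`, and `a`, `o` are position sequences with
`cost(a, ŝ) ≤ cost(o, ŝ)`, then `cost(a, s) − cost(o, s) ≤ 4q·(cost(a, s) + cost(o, s))`. -/
theorem stmt11 {X : Type*} [MetricSpace X]
    (huni : ∀ x y : X, x ≠ y → dist x y = 1)
    (D : ℕ) (hD : 0 < D) (p₀ : X) (n : ℕ) (hn : D ≤ n)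
    (q : ℝ) (hq : 0 ≤ q)
    (s shat : ℕ → X)
    (hm : ∀ i : ℕ, i + D ≤ n →
      (mismatches s shat (Finset.Icc (i + 1) (i + D)) : ℝ) ≤ q * D)
    (a o : ℕ → X) (ha0 : a 0 = p₀) (ho0 : o 0 = p₀)
    (hopt : pmCost (D : ℝ) n a shat ≤ pmCost (D : ℝ) n o shat) :
    pmCost (D : ℝ) n a s - pmCost (D : ℝ) n o s ≤
      4 * q * (pmCost (D : ℝ) n a s + pmCost (D : ℝ) n o s) := by
  classical
  let f : ℕ → ℝ := fun t => if s t ≠ shat t ∧ a t ≠ o t then 1 else 0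
  let g : ℕ → ℝ := fun t => (D * dist (a (t - 1)) (a t) + dist (a t) (s t)) +
    (D * dist (o (t - 1)) (o t) + dist (o t) (s t))
  have hf : ∀ t, 0 ≤ f t := fun t => by dsimp only [f]; split_ifs <;> norm_num
  have hg : ∀ t, 0 ≤ g t := fun t => by positivity
  have window : ∀ i, i + D ≤ n →
      ∑ t ∈ Ioc i (i + D), f t ≤ q * ∑ t ∈ Ioc i (i + D), g t := by
    intro i hi
    by_cases hne : ∃ t ∈ Ioc i (i + D), a t ≠ o t
    · have hmis : ∑ t ∈ Ioc i (i + D), f t ≤ mismatches s shat (Icc (i + 1) (i + D)) := by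
        have hIcc : Icc (i + 1) (i + D) = Ioc i (i + D) := by
          ext t
          simp
        rw [hIcc, mismatches, sum_boole]
        have hsub : {t ∈ Ioc i (i + D) | s t ≠ shat t ∧ a t ≠ o t} ⊆
            {t ∈ Ioc i (i + D) | s t ≠ shat t} := fun t ht => by
          rw [mem_filter] at ht ⊢
          exact ⟨ht.1, ht.2.1⟩
        exact_mod_cast card_le_card hsub
      exact (hmis.trans (hm i hi)).trans
        (mul_le_mul_of_nonneg_left (le_window_cost_of_exists_ne huni hne) hq)
    · push Not at hne
      rw [sum_eq_zero fun t ht => if_neg fun h => h.2 (hne t ht)]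
      exact mul_nonneg hq (sum_nonneg fun t _ => hg t)
  have total := sum_le_two_mul_of_window_sum_le hD hn hq hf hg window
  have exchange : ∀ t, dist (a t) (s t) - dist (o t) (s t) ≤
      dist (a t) (shat t) - dist (o t) (shat t) + 2 * f t := by
    intro t
    by_cases hs : s t = shat t
    · rw [hs]
      linarith [hf t]
    by_cases hao : a t = o t
    · rw [hao]
      linarith [hf t]
    have hft : f t = 1 := if_pos ⟨hs, hao⟩
    have hone := huni _ _ hao
    have := dist_triangle (a t) (o t) (s t)
    have := dist_triangle_left (o t) (shat t) (a t)
    linarith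
  have hIcc : Icc 1 n = Ioc 0 n := rfl
  have hdiff : pmCost D n a s - pmCost D n o s ≤
      pmCost D n a shat - pmCost D n o shat + 2 * ∑ t ∈ Ioc 0 n, f t := by
    simp only [pmCost, hIcc, mul_sum, ← sum_sub_distrib, ← sum_add_distrib]
    exact sum_le_sum fun t _ => by linarith [exchange t]
  have hsum : ∑ t ∈ Ioc 0 n, g t = pmCost D n a s + pmCost D n o s := by
    simp only [pmCost, hIcc, g, sum_add_distrib]
  rw [hsum] at total
  linarith
end

section
/- Let s be a request sequence, let 0 ≤ t₀ < t₁ ≤ n, and let a and o be position sequences that are both constant on the interval {t₀+1,…,t₁} (i.e., a(t) = a(t₁) and o(t) = o(t₁) for all t₀ < t ≤ t₁). Then cost_{t₁}(a,s) − cost_{t₀}(a,s) + cost_{t₁}(o,s) − cost_{t₀}(o,s) ≥ D·(d(a(t₀), a(t₁)) + d(o(t₀), o(t₁))) + (t₁ − t₀)·d(a(t₁), o(t₁)). -/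
open Finset

/-- A position sequence that moves to `x` right after time `t₀` and stays there up to time `t₁`
pays for a single move and for serving the requests from `x`. -/
theorem pmCost_eq_add_of_const {X : Type*} [MetricSpace X] (D : ℝ) {a s : ℕ → X} {x : X}
    {t₀ t₁ : ℕ} (h : t₀ < t₁) (ha : ∀ t, t₀ < t → t ≤ t₁ → a t = x) :
    pmCost D t₁ a s =
      pmCost D t₀ a s + D * dist (a t₀) x + ∑ t ∈ Finset.Ioc t₀ t₁, dist x (s t) := by
  induction t₁, h using Nat.le_induction with
  | base =>
    simp [pmCost_succ, ha (t₀ + 1) (by lia) le_rfl, add_assoc]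
  | succ m hm ih =>
    rw [pmCost_succ, ih fun t h₀ h₁ => ha t h₀ (by lia), ha m hm (by lia),
      ha (m + 1) (by lia) le_rfl, Finset.sum_Ioc_succ_top (by lia), dist_self]
    ring

/-- If `a` and `o` are position sequences both constant on the interval
`{t₀+1, …, t₁}`, then the sum of their partial-cost increments over this interval is at least
`D·(d(a t₀, a t₁) + d(o t₀, o t₁)) + (t₁ − t₀)·d(a t₁, o t₁)`. Here the partial cost up to
time `t` is `pmCost D t`. -/
theorem stmt13 {X : Type*} [MetricSpace X] (D : ℝ) (hD : 1 ≤ D) (p₀ : X) (n : ℕ)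
    (s : ℕ → X) (t₀ t₁ : ℕ) (h01 : t₀ < t₁) (h1n : t₁ ≤ n)
    (a o : ℕ → X) (ha0 : a 0 = p₀) (ho0 : o 0 = p₀)
    (haC : ∀ t : ℕ, t₀ < t → t ≤ t₁ → a t = a t₁)
    (hoC : ∀ t : ℕ, t₀ < t → t ≤ t₁ → o t = o t₁) :
    D * (dist (a t₀) (a t₁) + dist (o t₀) (o t₁)) +
        ((t₁ : ℝ) - (t₀ : ℝ)) * dist (a t₁) (o t₁) ≤
      pmCost D t₁ a s - pmCost D t₀ a s + (pmCost D t₁ o s - pmCost D t₀ o s) := by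
  have hsum : ((t₁ : ℝ) - t₀) * dist (a t₁) (o t₁) ≤
      ∑ t ∈ Finset.Ioc t₀ t₁, dist (a t₁) (s t) + ∑ t ∈ Finset.Ioc t₀ t₁, dist (o t₁) (s t) := by
    rw [← Finset.sum_add_distrib, ← Nat.cast_sub h01.le, ← Nat.card_Ioc, ← nsmul_eq_mul]
    exact Finset.card_nsmul_le_sum _ _ _ fun t _ => dist_triangle_right _ _ _
  rw [pmCost_eq_add_of_const D h01 haC, pmCost_eq_add_of_const D h01 hoC]
  linarith
end
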